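/- Let Ψ be an expansion system that is proper at every order w.r.t. every element of S_0, endow ∏_{i∈ℕ} C_i with the product topology 𝒟* in which each C_i is discrete, and suppose the topology on S_0 is coarser than or equal to the topology induced by P̂ from the discrete topology on ∏ C_i. If P̂ is closed at the point ĉ = P̂ y (meaning: for every open set U ⊇ P̂^{−1}(ĉ) in S_0 there is a 𝒟*-open neighborhood V of ĉ with P̂^{−1}(V) ⊆ U), then the convergents y^{[n]} converge to y in S_0, i.e. Ψ is accurate w.r.t. y. -/

import Mathlib

/-- An *expansion system* `Ψ`: element spaces `S i` with neutral elements `ν i`,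
coefficient spaces `C i`, projections `P i : S i → C i` and expansions
`E i : S i → S (i+1)` such that `E i (ν i) = ν (i+1)` and each combined map
`F i = (P i, E i) : S i → C i × S (i+1)` is injective. -/
structure ExpansionSystem where
  S : ℕ → Type*
  C : ℕ → Type*
  ν : ∀ i, S i
  P : ∀ i, S i → C i
  E : ∀ i, S i → S (i + 1)
  E_ν : ∀ i, E i (ν i) = ν (i + 1)
  F_inj : ∀ i, Function.Injective (fun y : S i => (P i y, E i y))

namespace ExpansionSystem

variable (Ψ : ExpansionSystem)

/-- `iter Ψ i y` is the element `y_i`: `y_0 = y`, `y_{i+1} = E i y_i`. -/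
def iter : ∀ i : ℕ, Ψ.S 0 → Ψ.S i
  | 0, y => y
  | (i + 1), y => Ψ.E i (iter i y)

/-- The `i`-th coefficient `P̂_i y = P i (y_i)`. -/
def coeff (i : ℕ) (y : Ψ.S 0) : Ψ.C i := Ψ.P i (Ψ.iter i y)

/-- The coefficient map `P̂ : S 0 → ∏ i, C i`. -/
def coeffMap (y : Ψ.S 0) : ∀ i, Ψ.C i := fun i => Ψ.coeff i y

/-- `a` records the backward recursion defining the `n`-th convergent of `y`:
`a n = ν n` and, for `i < n`, `F i (a i) = (P̂_i y, a (i+1))`, i.e.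
`a i = F i ⁻¹ (P̂_i y, a (i+1))`; in particular at each step the pair
`(P̂_i y, a (i+1))` lies in the image of `F i`. -/
def IsChain (n : ℕ) (y : Ψ.S 0) (a : ∀ i, Ψ.S i) : Prop :=
  a n = Ψ.ν n ∧ ∀ i < n, Ψ.P i (a i) = Ψ.coeff i y ∧ Ψ.E i (a i) = a (i + 1)

/-- `Ψ` is *proper at order `n` w.r.t. `y`*: the backward recursion
`y_n^[n] = ν n`, `y_i^[n] = F i ⁻¹ (P̂_i y, y_{i+1}^[n])` is well defined. -/
def ProperAt (n : ℕ) (y : Ψ.S 0) : Prop := ∃ a, Ψ.IsChain n y a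

/-- `z` is the `n`-th convergent `y^[n]` of `y` (the outcome `y_0^[n]` of the
backward recursion). -/
def IsConvergent (n : ℕ) (y z : Ψ.S 0) : Prop := ∃ a, Ψ.IsChain n y a ∧ a 0 = z

end ExpansionSystem

/-- The product topology `𝒟*` on `∏ i, C i` in which each `C i` is discrete. -/
def ExpansionSystem.discreteProd (Ψ : ExpansionSystem) : TopologicalSpace (∀ i, Ψ.C i) :=
  @Pi.topologicalSpace ℕ (fun i => Ψ.C i) (fun _ => ⊥)

namespace ExpansionSystem

variable {Ψ : ExpansionSystem}

theorem IsChain.iter_eq {n : ℕ} {y : Ψ.S 0} {a : ∀ i, Ψ.S i} (h : Ψ.IsChain n y a) :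
    ∀ i ≤ n, Ψ.iter i (a 0) = a i
  | 0, _ => rfl
  | i + 1, hi => by
    rw [iter, h.iter_eq i (by lia)]
    exact (h.2 i hi).2

/-- The first `n` coefficients of the `n`-th convergent of `y` are those of `y`. -/
theorem IsConvergent.coeff_eq {n : ℕ} {y z : Ψ.S 0} (h : Ψ.IsConvergent n y z) {i : ℕ}
    (hi : i < n) : Ψ.coeff i z = Ψ.coeff i y := by
  obtain ⟨a, ha, rfl⟩ := h
  rw [coeff, ha.iter_eq i hi.le]
  exact (ha.2 i hi).1

/-- The coefficients of the convergents of `y` converge to those of `y`. -/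
theorem tendsto_coeffMap_of_isConvergent {y : Ψ.S 0} {c : ℕ → Ψ.S 0}
    (hc : ∀ n, Ψ.IsConvergent n y (c n)) :
    Filter.Tendsto (fun n => Ψ.coeffMap (c n)) Filter.atTop
      (@nhds _ Ψ.discreteProd (Ψ.coeffMap y)) := by
  let : ∀ i, TopologicalSpace (Ψ.C i) := fun _ => ⊥
  refine tendsto_pi_nhds.2 fun i => tendsto_const_nhds.congr' ?_
  filter_upwards [Filter.eventually_gt_atTop i] with n hn
  exact ((hc n).coeff_eq hn).symm

end ExpansionSystem

/-- let `Ψ` be proper at every order w.r.t. every element, endow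
`∏ i, C i` with the product topology `𝒟*` of discrete topologies, and let the
topology `tS` on `S 0` be coarser than or equal to the topology induced by `P̂`
from the discrete topology on `∏ i, C i`. If `P̂` is closed at the point
`ĉ = P̂ y` (for every `tS`-open `U ⊇ P̂ ⁻¹' {ĉ}` there is a `𝒟*`-open
neighborhood `V` of `ĉ` with `P̂ ⁻¹' V ⊆ U`), then the convergents `y^[n]`
converge to `y` in `tS`, i.e. `Ψ` is accurate w.r.t. `y`. -/
theorem stmt9 (Ψ : ExpansionSystem) (tS : TopologicalSpace (Ψ.S 0))
    (hproper : ∀ (z : Ψ.S 0) (n : ℕ), Ψ.ProperAt n z)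
    (hcoarse : TopologicalSpace.induced Ψ.coeffMap (⊥ : TopologicalSpace (∀ i, Ψ.C i)) ≤ tS)
    (y : Ψ.S 0)
    (hclosed : ∀ U : Set (Ψ.S 0), tS.IsOpen U → Ψ.coeffMap ⁻¹' {Ψ.coeffMap y} ⊆ U →
      ∃ V : Set (∀ i, Ψ.C i), Ψ.discreteProd.IsOpen V ∧ Ψ.coeffMap y ∈ V ∧
        Ψ.coeffMap ⁻¹' V ⊆ U)
    (c : ℕ → Ψ.S 0) (hc : ∀ n, Ψ.IsConvergent n y (c n)) :
    Filter.Tendsto c Filter.atTop (@nhds _ tS y) := by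
  refine (tendsto_nhds (X := Ψ.S 0)).2 fun U hU hyU => ?_
  obtain ⟨A, -, rfl⟩ := hcoarse U hU
  have hfiber : Ψ.coeffMap ⁻¹' {Ψ.coeffMap y} ⊆ Ψ.coeffMap ⁻¹' A :=
    Set.preimage_mono (Set.singleton_subset_iff.2 hyU)
  obtain ⟨V, hV, hyV, hVU⟩ := hclosed _ hU hfiber
  have hnhds : V ∈ @nhds _ Ψ.discreteProd (Ψ.coeffMap y) :=
    let := Ψ.discreteProd
    IsOpen.mem_nhds hV hyV
  filter_upwards [ExpansionSystem.tendsto_coeffMap_of_isConvergent hc hnhds] with n hn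
  exact hVU hn
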